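/- Let n ≥ 1, let a ∈ ℂ^n with a·a = 1, let B_{n,3} = 2(n+4)/(5(n+1)), and set f = (1/B_{n,3})·q_n^3 − (a·x)^6. Then the kernel of the middle catalecticant map Cat_{f,3} is the one-dimensional space spanned by (n+4)·(a·Y)^3 − 3·q_n(Y)·(a·Y), where a·Y = a_1Y_1+⋯+a_nY_n and q_n(Y) = Y_1^2+⋯+Y_n^2. -/

import Mathlib

open MvPolynomial

noncomputable def qpoly (n : ℕ) : MvPolynomial (Fin n) ℂ :=
  ∑ i : Fin n, X i ^ 2

noncomputable def linForm {n : ℕ} (a : Fin n → ℂ) : MvPolynomial (Fin n) ℂ :=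
  ∑ i : Fin n, C (a i) * X i

noncomputable def dotC {n : ℕ} (a b : Fin n → ℂ) : ℂ :=
  ∑ i : Fin n, a i * b i

noncomputable def diffOp {n : ℕ} (φ f : MvPolynomial (Fin n) ℂ) : MvPolynomial (Fin n) ℂ :=
  ∑ d ∈ φ.support, φ.coeff d •
    ((List.ofFn fun i : Fin n =>
        ((pderiv i).toLinearMap : MvPolynomial (Fin n) ℂ →ₗ[ℂ] MvPolynomial (Fin n) ℂ) ^ d i).prod f)

noncomputable def lap {n : ℕ} (f : MvPolynomial (Fin n) ℂ) : MvPolynomial (Fin n) ℂ :=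
  ∑ i : Fin n, pderiv i (pderiv i f)

theorem List.prod_map_pow_add_single {n : ℕ} {M : Type*} [Monoid M] (D : Fin n → M)
    (hD : ∀ i j, Commute (D i) (D j)) (d : Fin n →₀ ℕ) (i : Fin n) (l : List (Fin n))
    (hl : l.Nodup) (hi : i ∈ l) :
    (l.map fun j => D j ^ (Finsupp.single i 1 + d : Fin n →₀ ℕ) j).prod =
      D i * (l.map fun j => D j ^ d j).prod := by
  induction l with
  | nil => simp at hi
  | cons j l ih =>
    rw [List.nodup_cons] at hl
    simp only [List.map_cons, List.prod_cons]
    by_cases hji : i = j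
    · subst hji
      have h : (l.map fun j => D j ^ (Finsupp.single i 1 + d : Fin n →₀ ℕ) j) =
          l.map fun j => D j ^ d j := by
        refine List.map_congr_left fun k hk => ?_
        have : i ≠ k := fun h => hl.1 (h ▸ hk)
        simp [this]
      rw [h, ← mul_assoc]
      simp [add_comm 1, pow_succ']
    · have hil : i ∈ l := by simpa [hji] using hi
      rw [ih hl.2 hil, ← mul_assoc, ← mul_assoc]
      congr 1
      simpa [Finsupp.single_apply, hji] using ((hD j i).pow_left (d j)).eq

theorem commute_pderiv {n : ℕ} (i j : Fin n) :
    Commute ((pderiv i).toLinearMap : Module.End ℂ (MvPolynomial (Fin n) ℂ))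
      (pderiv j).toLinearMap := by
  have h : ⁅(pderiv i : Derivation ℂ (MvPolynomial (Fin n) ℂ) (MvPolynomial (Fin n) ℂ)),
      (pderiv j : Derivation ℂ (MvPolynomial (Fin n) ℂ) (MvPolynomial (Fin n) ℂ))⁆ = 0 := by
    refine MvPolynomial.derivation_ext fun k => ?_
    simp only [Derivation.commutator_apply, pderiv_X, Derivation.zero_apply, Pi.single_apply]
    split_ifs <;> simp
  refine LinearMap.ext fun f => ?_
  have := congrArg (fun D => D f) h
  simpa [Derivation.commutator_apply, sub_eq_zero] using this

theorem diffOp_monomial {n : ℕ} (d : Fin n →₀ ℕ) (c : ℂ) (f : MvPolynomial (Fin n) ℂ) :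
    diffOp (monomial d c) f = c • ((List.ofFn fun i : Fin n =>
      ((pderiv i).toLinearMap : MvPolynomial (Fin n) ℂ →ₗ[ℂ] MvPolynomial (Fin n) ℂ) ^ d i).prod
        f) := by
  unfold diffOp
  by_cases hc : c = 0
  · simp [hc]
  · rw [support_monomial, if_neg hc]
    simp

theorem diffOp_add {n : ℕ} (φ ψ f : MvPolynomial (Fin n) ℂ) :
    diffOp (φ + ψ) f = diffOp φ f + diffOp ψ f := by
  have h (χ : MvPolynomial (Fin n) ℂ) (hχ : χ.support ⊆ φ.support ∪ ψ.support) :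
      diffOp χ f = ∑ d ∈ φ.support ∪ ψ.support, χ.coeff d • ((List.ofFn fun i : Fin n =>
        ((pderiv i).toLinearMap : MvPolynomial (Fin n) ℂ →ₗ[ℂ] MvPolynomial (Fin n) ℂ) ^ d i).prod
          f) :=
    Finset.sum_subset hχ fun d _ hd => by rw [notMem_support_iff.mp hd, zero_smul]
  rw [h _ support_add, h φ Finset.subset_union_left, h ψ Finset.subset_union_right,
    ← Finset.sum_add_distrib]
  simp only [coeff_add, add_smul]

theorem diffOp_smul {n : ℕ} (c : ℂ) (φ f : MvPolynomial (Fin n) ℂ) :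
    diffOp (c • φ) f = c • diffOp φ f := by
  induction φ using MvPolynomial.induction_on' with
  | monomial d r => rw [smul_monomial, diffOp_monomial, diffOp_monomial, smul_assoc]
  | add p q hp hq => rw [smul_add, diffOp_add, diffOp_add, hp, hq, smul_add]

theorem diffOp_sub_C_mul {n : ℕ} (φ f g : MvPolynomial (Fin n) ℂ) (c : ℂ) :
    diffOp φ (C c * f - g) = C c * diffOp φ f - diffOp φ g := by
  simp only [diffOp, ← smul_eq_C_mul, map_sub, map_smul, smul_sub, Finset.sum_sub_distrib,
    Finset.smul_sum]
  congr 1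
  exact Finset.sum_congr rfl fun _ _ => smul_comm _ _ _

theorem diffOp_one {n : ℕ} (f : MvPolynomial (Fin n) ℂ) : diffOp 1 f = f := by
  rw [← C_1, ← monomial_zero', diffOp_monomial]
  simp

theorem diffOp_X_mul {n : ℕ} (i : Fin n) (φ f : MvPolynomial (Fin n) ℂ) :
    diffOp (X i * φ) f = pderiv i (diffOp φ f) := by
  induction φ using MvPolynomial.induction_on' with
  | monomial d r =>
    rw [X, monomial_mul, one_mul, diffOp_monomial, diffOp_monomial, List.ofFn_eq_map,
      List.prod_map_pow_add_single _ commute_pderiv d i _ (List.nodup_finRange n)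
        (List.mem_finRange i), List.ofFn_eq_map]
    simp
  | add p q hp hq => rw [mul_add, diffOp_add, diffOp_add, hp, hq, map_add]

theorem MvPolynomial.IsHomogeneous.induction_three {n : ℕ}
    {P : MvPolynomial (Fin n) ℂ → Prop} (hX : ∀ i j k, P (X i * (X j * X k)))
    (h0 : P 0) (hadd : ∀ p q, P p → P q → P (p + q)) (hsmul : ∀ (c : ℂ) p, P p → P (c • p))
    {φ : MvPolynomial (Fin n) ℂ} (hφ : φ.IsHomogeneous 3) : P φ := by
  rw [φ.as_sum]
  refine Finset.sum_induction _ P hadd h0 fun d hd => ?_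
  have hdeg : (Finsupp.toMultiset d).card = 3 := by
    have := hφ (mem_support_iff.mp hd)
    have hw : d.degree = Finsupp.weight 1 d := congrArg (· d) Finsupp.degree_eq_weight_one
    rw [← hw] at this
    rw [Finsupp.card_toMultiset]
    exact this
  obtain ⟨i, j, k, hijk⟩ := Multiset.card_eq_three.mp hdeg
  have hm : monomial d (1 : ℂ) = X i * (X j * X k) := by
    have hd' : d = Finsupp.single i 1 + (Finsupp.single j 1 + Finsupp.single k 1) := by
      apply Finsupp.orderIsoMultiset.injective
      simp only [Finsupp.coe_orderIsoMultiset]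
      rw [hijk]
      simp only [map_add, Finsupp.toMultiset_single, one_smul]
      rfl
    rw [hd']
    simp [X, monomial_mul]
  have : monomial d (coeff d φ) = coeff d φ • monomial d (1 : ℂ) := by
    rw [smul_monomial, smul_eq_mul, mul_one]
  rw [this, hm]
  exact hsmul _ _ (hX i j k)

theorem pderiv_qpoly {n : ℕ} (i : Fin n) : pderiv i (qpoly n) = 2 * X i := by
  simp [qpoly, pderiv_X, Pi.single_apply, Derivation.leibniz_pow, mul_comm]

theorem pderiv_linForm {n : ℕ} (a : Fin n → ℂ) (i : Fin n) :
    pderiv i (linForm a) = C (a i) := by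
  simp [linForm, pderiv_X, Pi.single_apply]

theorem lap_add {n : ℕ} (f g : MvPolynomial (Fin n) ℂ) : lap (f + g) = lap f + lap g := by
  simp [lap, Finset.sum_add_distrib]

theorem lap_smul {n : ℕ} (c : ℂ) (f : MvPolynomial (Fin n) ℂ) : lap (c • f) = c • lap f := by
  simp [lap, Finset.smul_sum]

theorem lap_mul {n : ℕ} (f g : MvPolynomial (Fin n) ℂ) :
    lap (f * g) = lap f * g + 2 * ∑ i, pderiv i f * pderiv i g + f * lap g := by
  simp only [lap, Finset.sum_mul, Finset.mul_sum, ← Finset.sum_add_distrib]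
  refine Finset.sum_congr rfl fun i _ => ?_
  simp only [Derivation.leibniz, map_add, smul_eq_mul]
  ring

theorem lap_X {n : ℕ} (i : Fin n) : lap (X i : MvPolynomial (Fin n) ℂ) = 0 := by
  refine Finset.sum_eq_zero fun j _ => ?_
  rw [pderiv_X, Pi.single_apply]
  split_ifs <;> simp

theorem pderiv_X_eq_ite {n : ℕ} (i j : Fin n) :
    pderiv i (X j : MvPolynomial (Fin n) ℂ) = C (if i = j then 1 else 0) := by
  rw [pderiv_X, Pi.single_apply]
  split_ifs <;> simp_all

theorem lap_X_mul_X_mul_X {n : ℕ} (i j k : Fin n) :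
    lap (X i * (X j * X k) : MvPolynomial (Fin n) ℂ) =
      2 * (pderiv i (X j) * X k + pderiv i (X k) * X j + pderiv j (X k) * X i) := by
  have h (i : Fin n) (f : MvPolynomial (Fin n) ℂ) :
      ∑ l, pderiv l (X i) * pderiv l f = pderiv i f := by
    simp [pderiv_X, Pi.single_apply]
  rw [lap_mul, lap_mul, h, h, lap_X, lap_X, lap_X, Derivation.leibniz]
  simp only [smul_eq_mul]
  ring

theorem diffOp_qpoly_pow_three {n : ℕ} {φ : MvPolynomial (Fin n) ℂ} (hφ : φ.IsHomogeneous 3) :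
    diffOp φ (qpoly n ^ 3) = 48 * φ + 12 * (qpoly n * lap φ) := by
  refine hφ.induction_three (P := fun φ => diffOp φ (qpoly n ^ 3) =
    48 * φ + 12 * (qpoly n * lap φ)) (fun i j k => ?_) (by simp [diffOp, lap]) (fun p q hp hq => ?_)
    fun c p hp => ?_
  · rw [lap_X_mul_X_mul_X, ← mul_one (X k), diffOp_X_mul, diffOp_X_mul, diffOp_X_mul, diffOp_one]
    have h2 (i : Fin n) : pderiv i (2 : MvPolynomial (Fin n) ℂ) = 0 :=
      pderiv_C (R := ℂ) (a := 2)
    simp only [pow_succ, pow_zero, one_mul, mul_one, Derivation.leibniz, map_add, map_zero,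
      smul_eq_mul, pderiv_qpoly, h2, pderiv_X_eq_ite, pderiv_C]
    ring
  · rw [diffOp_add, lap_add, hp, hq]; ring
  · rw [diffOp_smul, lap_smul, hp]
    simp only [smul_eq_C_mul]; ring

theorem diffOp_linForm_pow_six {n : ℕ} (a : Fin n → ℂ) {φ : MvPolynomial (Fin n) ℂ}
    (hφ : φ.IsHomogeneous 3) :
    diffOp φ (linForm a ^ 6) = 120 * C (eval a φ) * linForm a ^ 3 := by
  refine hφ.induction_three (P := fun φ => diffOp φ (linForm a ^ 6) =
    120 * C (eval a φ) * linForm a ^ 3) (fun i j k => ?_) (by simp [diffOp]) (fun p q hp hq => ?_)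
    fun c p hp => ?_
  · rw [← mul_one (X k), diffOp_X_mul, diffOp_X_mul, diffOp_X_mul, diffOp_one]
    simp only [pow_succ, pow_zero, one_mul, mul_one, Derivation.leibniz, map_add, map_zero,
      smul_eq_mul, pderiv_linForm, pderiv_C, eval_X, map_mul]
    ring
  · rw [diffOp_add, hp, hq, map_add, C_add]; ring
  · rw [diffOp_smul, hp, smul_eval, C_mul]
    simp only [smul_eq_C_mul]; ring

theorem isHomogeneous_qpoly (n : ℕ) : (qpoly n).IsHomogeneous 2 :=
  IsHomogeneous.sum _ _ _ fun i _ => by simpa using (isHomogeneous_X ℂ i).pow 2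

theorem isHomogeneous_linForm {n : ℕ} (a : Fin n → ℂ) : (linForm a).IsHomogeneous 1 :=
  IsHomogeneous.sum _ _ _ fun i _ => by
    simpa using (isHomogeneous_C _ (a i)).mul (isHomogeneous_X ℂ i)

theorem MvPolynomial.IsHomogeneous.lap {n m : ℕ} {f : MvPolynomial (Fin n) ℂ}
    (hf : f.IsHomogeneous m) : (lap f).IsHomogeneous (m - 1 - 1) :=
  IsHomogeneous.sum _ _ _ fun _ _ => hf.pderiv.pderiv

theorem lap_eq_zero_of_isHomogeneous_one {n : ℕ} {f : MvPolynomial (Fin n) ℂ}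
    (hf : f.IsHomogeneous 1) : lap f = 0 := by
  refine Finset.sum_eq_zero fun i _ => ?_
  have h : (pderiv i f).IsHomogeneous 0 := hf.pderiv
  rw [totalDegree_eq_zero_iff_eq_C.mp (Nat.le_zero.mp h.totalDegree_le), pderiv_C]

theorem lap_qpoly (n : ℕ) : lap (qpoly n) = C (2 * n : ℂ) := by
  simp only [lap, pderiv_qpoly]
  have h2 (i : Fin n) : pderiv i (2 : MvPolynomial (Fin n) ℂ) = 0 :=
    pderiv_C (R := ℂ) (a := 2)
  simp [Derivation.leibniz, h2, mul_comm, C_mul,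
    show (C 2 : MvPolynomial (Fin n) ℂ) = 2 from map_ofNat C 2]

theorem lap_qpoly_mul {n : ℕ} {f : MvPolynomial (Fin n) ℂ} (hf : f.IsHomogeneous 1) :
    lap (qpoly n * f) = C (2 * n + 4 : ℂ) * f := by
  have h : ∑ i, pderiv i (qpoly n) * pderiv i f = 2 * f := by
    simp only [pderiv_qpoly, mul_assoc, ← Finset.mul_sum]
    rw [hf.sum_X_mul_pderiv, one_smul]
  rw [lap_mul, h, lap_qpoly, lap_eq_zero_of_isHomogeneous_one hf]
  simp only [C_add, map_ofNat]
  ring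

theorem lap_linForm_pow_three {n : ℕ} {a : Fin n → ℂ} (ha : dotC a a = 1) :
    lap (linForm a ^ 3) = 6 * linForm a := by
  have h : ∀ i, pderiv i (pderiv i (linForm a ^ 3)) = C (a i * a i) * (6 * linForm a) := by
    intro i
    simp only [pow_succ, pow_zero, one_mul, Derivation.leibniz, map_add, smul_eq_mul,
      pderiv_linForm, pderiv_C, C_mul]
    ring
  simp only [lap, h, ← Finset.sum_mul, ← map_sum]
  have h1 : ∑ i, a i * a i = 1 := ha
  rw [h1, C_1, one_mul]

theorem eval_linForm {n : ℕ} (a b : Fin n → ℂ) : eval b (linForm a) = dotC a b := by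
  simp [linForm, dotC]

theorem eval_qpoly {n : ℕ} (b : Fin n → ℂ) : eval b (qpoly n) = dotC b b := by
  simp [qpoly, dotC, sq]

/-- For a·a = 1 and f = (1/B_{n,3})·q_n^3 − (a·x)^6 with
B_{n,3} = 2(n+4)/(5(n+1)), the kernel of Cat_{f,3} is spanned by
(n+4)(a·Y)³ − 3·q_n(Y)·(a·Y). -/
theorem kernel_middle_catalecticant_s3 (n : ℕ) (hn : 1 ≤ n)
    (a : Fin n → ℂ) (ha : dotC a a = 1) (f : MvPolynomial (Fin n) ℂ)
    (hf : f = C ((2 * ((n : ℂ) + 4) / (5 * ((n : ℂ) + 1)))⁻¹) * qpoly n ^ 3 - linForm a ^ 6) :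
    ∀ φ : MvPolynomial (Fin n) ℂ,
      (φ.IsHomogeneous 3 ∧ diffOp φ f = 0) ↔
        ∃ c : ℂ, φ = c • (C ((n : ℂ) + 4) * linForm a ^ 3 - C 3 * (qpoly n * linForm a)) := by
  intro φ
  have h1 : (n : ℂ) + 1 ≠ 0 := by exact_mod_cast (show n + 1 ≠ 0 by omega)
  have h4 : (n : ℂ) + 4 ≠ 0 := by exact_mod_cast (show n + 4 ≠ 0 by omega)
  set β : ℂ := (2 * ((n : ℂ) + 4) / (5 * ((n : ℂ) + 1)))⁻¹ with hβ
  have hβ0 : β ≠ 0 := by rw [hβ]; simp [h1, h4]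
  have key (φ : MvPolynomial (Fin n) ℂ) (hφ : φ.IsHomogeneous 3) : diffOp φ f =
      C β * (48 * φ + 12 * (qpoly n * lap φ)) - 120 * C (eval a φ) * linForm a ^ 3 := by
    rw [hf, diffOp_sub_C_mul, diffOp_qpoly_pow_three hφ, diffOp_linForm_pow_six a hφ]
  have hL := isHomogeneous_linForm a
  constructor
  · rintro ⟨hφ, h⟩
    rw [key φ hφ] at h
    have hψ : (lap φ).IsHomogeneous 1 := hφ.lap
    set t : ℂ := β⁻¹ * (5 / 2) * eval a φ with ht
    have hφ' : φ = t • linForm a ^ 3 + (-1 / 4 : ℂ) • (qpoly n * lap φ) := by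
      have hb : C β⁻¹ * C β = (1 : MvPolynomial (Fin n) ℂ) := by
        rw [← C_mul, inv_mul_cancel₀ hβ0, C_1]
      have e1 : (C (1 / 48 : ℂ) : MvPolynomial (Fin n) ℂ) * 48 = 1 := by
        rw [← map_ofNat C 48, ← C_mul]; norm_num
      have e2 : (C (5 / 2 : ℂ) : MvPolynomial (Fin n) ℂ) = C (1 / 48) * 120 := by
        rw [← map_ofNat C 120, ← C_mul]; norm_num
      have e3 : (C (-1 / 4 : ℂ) : MvPolynomial (Fin n) ℂ) = - (C (1 / 48) * 12) := by
        rw [← map_ofNat C 12, ← C_mul, ← C_neg]; norm_num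
      simp only [smul_eq_C_mul, ht, C_mul, e2, e3]
      linear_combination C β⁻¹ * C (1 / 48) * h
        - (C (1 / 48) * (48 * φ + 12 * (qpoly n * lap φ))) * hb - φ * e1
    have hlap : lap φ = (12 * t / (n + 4)) • linForm a := by
      have h' := congrArg lap hφ'
      rw [lap_add, lap_smul, lap_smul, lap_linForm_pow_three ha, lap_qpoly_mul hψ] at h'
      have h'' : ((n + 4 : ℂ) / 2) • lap φ = (6 * t) • linForm a := by
        rw [← map_ofNat C 6] at h'
        simp only [smul_eq_C_mul] at h' ⊢
        have e : (C ((n + 4 : ℂ) / 2) : MvPolynomial (Fin n) ℂ)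
            = 1 - C (-1 / 4 : ℂ) * C (2 * n + 4 : ℂ) := by
          rw [← C_mul, ← C_1, ← C_sub]; congr 1; ring
        rw [e, C_mul]
        linear_combination h'
      have h3 := congrArg (fun p => (2 / (n + 4 : ℂ)) • p) h''
      simp only [smul_smul] at h3
      rw [show 2 / (n + 4 : ℂ) * ((n + 4) / 2) = 1 by field_simp, one_smul] at h3
      rw [h3]
      congr 1
      ring
    refine ⟨t / (n + 4), ?_⟩
    rw [hφ', hlap]
    simp only [smul_eq_C_mul, mul_sub]
    have e1 : (C t : MvPolynomial (Fin n) ℂ) = C (t / (n + 4)) * C (n + 4 : ℂ) := by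
      rw [← C_mul, div_mul_cancel₀ _ h4]
    have e2 : (C (-1 / 4) * C (12 * t / (n + 4)) : MvPolynomial (Fin n) ℂ)
        = - (C (t / (n + 4)) * C 3) := by
      rw [← C_mul, ← C_mul, ← C_neg]; congr 1; ring
    linear_combination linForm a ^ 3 * e1 + qpoly n * linForm a * e2
  · rintro ⟨c, rfl⟩
    have hG : (C ((n : ℂ) + 4) * linForm a ^ 3 - C 3 * (qpoly n * linForm a)).IsHomogeneous 3 := by
      refine IsHomogeneous.sub ?_ ?_
      · simpa using (isHomogeneous_C _ ((n : ℂ) + 4)).mul (hL.pow 3)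
      · simpa using (isHomogeneous_C _ (3 : ℂ)).mul ((isHomogeneous_qpoly n).mul hL)
    refine ⟨?_, ?_⟩
    · rw [smul_eq_C_mul]
      simpa using (isHomogeneous_C _ c).mul hG
    · rw [diffOp_smul, key _ hG]
      have hlap : lap (C ((n : ℂ) + 4) * linForm a ^ 3 - C 3 * (qpoly n * linForm a))
          = 12 * linForm a := by
        rw [sub_eq_add_neg, ← neg_mul, ← C_neg, ← smul_eq_C_mul, ← smul_eq_C_mul, lap_add, lap_smul,
          lap_smul, lap_linForm_pow_three ha, lap_qpoly_mul hL]
        simp only [smul_eq_C_mul, C_add, C_mul, C_neg, map_ofNat]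
        ring
      have hev : eval a (C ((n : ℂ) + 4) * linForm a ^ 3 - C 3 * (qpoly n * linForm a))
          = n + 1 := by
        simp only [map_sub, map_mul, map_pow, eval_C, eval_linForm, eval_qpoly, ha]
        ring
      have hβ' : (C β * C (n + 4 : ℂ) * 48 : MvPolynomial (Fin n) ℂ) = 120 * C (n + 1 : ℂ) := by
        rw [← map_ofNat C 48, ← map_ofNat C 120, ← C_mul, ← C_mul, ← C_mul]
        congr 1
        rw [hβ]
        field_simp
        norm_num
      rw [hlap, hev, map_ofNat]
      refine smul_eq_zero_of_right _ ?_
      linear_combination linForm a ^ 3 * hβ'
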